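/- Let n ≥ 1 and let S be a finite abelian subgroup of the group of units of M_{2^n}(ℂ) whose elements are all signed Pauli strings, with −1 ∉ S, generated by n − k independent commuting generators (so |S| = 2^{n−k}). Then the stabilized subspace V_S = {v ∈ ℂ^{2^n} : s·v = v for all s ∈ S} has dimension 2^k. -/

import Mathlib

open Matrix

/-- The 2 × 2 identity matrix `I`. -/
noncomputable def PauliI : Matrix (Fin 2) (Fin 2) ℂ := 1

/-- The Pauli spin matrix `X = [[0,1],[1,0]]`. -/
noncomputable def PauliX : Matrix (Fin 2) (Fin 2) ℂ := !![0, 1; 1, 0]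

/-- The Pauli spin matrix `Y = [[0,-i],[i,0]]`. -/
noncomputable def PauliY : Matrix (Fin 2) (Fin 2) ℂ := !![0, -Complex.I; Complex.I, 0]

/-- The Pauli spin matrix `Z = [[1,0],[0,-1]]`. -/
noncomputable def PauliZ : Matrix (Fin 2) (Fin 2) ℂ := !![1, 0; 0, -1]

/-- The four single-qubit Pauli matrices `I, X, Y, Z`, indexed by `Fin 4`. -/
noncomputable def pauli : Fin 4 → Matrix (Fin 2) (Fin 2) ℂ := ![PauliI, PauliX, PauliY, PauliZ]

/-- The Pauli string `P f = ⊗_{k < n} pauli (f k)`, the `n`-fold Kronecker (tensor)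
product of single-qubit Pauli matrices, realized as a `2^n × 2^n` complex matrix
indexed by `Fin n → Fin 2`. -/
noncomputable def PauliString (n : ℕ) (f : Fin n → Fin 4) :
    Matrix (Fin n → Fin 2) (Fin n → Fin 2) ℂ :=
  Matrix.of fun i j => ∏ k, pauli (f k) (i k) (j k)

/-- The tautological representation on column vectors of a group of invertible matrices. -/
noncomputable def tautologicalRep {m : Type*} [Fintype m] [DecidableEq m]
    (S : Subgroup (Matrix m m ℂ)ˣ) : Representation ℂ S (m → ℂ) :=
  (Matrix.toLinAlgEquiv' : Matrix m m ℂ ≃ₐ[ℂ] _).toMonoidHom.comp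
    ((Units.coeHom (Matrix m m ℂ)).comp S.subtype)

theorem tautologicalRep_apply {m : Type*} [Fintype m] [DecidableEq m]
    (S : Subgroup (Matrix m m ℂ)ˣ) (s : S) :
    tautologicalRep S s = Matrix.toLin' ((s : (Matrix m m ℂ)ˣ) : Matrix m m ℂ) := rfl

theorem invariants_tautologicalRep {m : Type*} [Fintype m] [DecidableEq m]
    (S : Subgroup (Matrix m m ℂ)ˣ) :
    (tautologicalRep S).invariants =
      ⨅ s ∈ S, LinearMap.eqLocus (Matrix.mulVecLin (s : Matrix m m ℂ)) LinearMap.id := by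
  ext v
  simp [Representation.mem_invariants, tautologicalRep_apply, Submodule.mem_iInf]

theorem trace_PauliString (n : ℕ) (f : Fin n → Fin 4) :
    (PauliString n f).trace = ∏ k, (pauli (f k)).trace := by
  simp only [Matrix.trace, Matrix.diag_apply, PauliString, Matrix.of_apply]
  rw [Finset.prod_univ_sum, Fintype.piFinset_univ]

theorem trace_pauli_of_ne_zero {a : Fin 4} (ha : a ≠ 0) : (pauli a).trace = 0 := by
  fin_cases a <;> simp_all [pauli, PauliX, PauliY, PauliZ, Matrix.trace_fin_two]

theorem trace_PauliString_of_ne_zero {n : ℕ} {f : Fin n → Fin 4} (hf : f ≠ 0) :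
    (PauliString n f).trace = 0 := by
  obtain ⟨k, hk⟩ := Function.ne_iff.mp hf
  rw [trace_PauliString]
  exact Finset.prod_eq_zero (Finset.mem_univ k) (trace_pauli_of_ne_zero hk)

theorem PauliString_zero (n : ℕ) : PauliString n 0 = 1 := by
  ext i j
  simp only [PauliString, Matrix.of_apply, pauli, PauliI, Pi.zero_apply, Matrix.cons_val_zero,
    Matrix.one_apply, Finset.prod_boole, Finset.mem_univ, true_imp_iff, funext_iff]

/-- An `[n,k]` stabilizer group: a finite abelian subgroup of signed Pauli strings
with `-1 ∉ S` and `|S| = 2^(n-k)` (i.e. `n - k` independent commuting generators)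
stabilizes a subspace `V_S = {v | s · v = v for all s ∈ S}` of dimension `2^k`. -/
theorem stabilizer_code_dimension (n k : ℕ) (hn : 1 ≤ n) (hk : k ≤ n)
    (S : Subgroup (Matrix (Fin n → Fin 2) (Fin n → Fin 2) ℂ)ˣ)
    (habel : ∀ a ∈ S, ∀ b ∈ S, a * b = b * a)
    (hpauli : ∀ s ∈ S, ∃ f : Fin n → Fin 4,
        (s : Matrix (Fin n → Fin 2) (Fin n → Fin 2) ℂ) = PauliString n f ∨
        (s : Matrix (Fin n → Fin 2) (Fin n → Fin 2) ℂ) = -PauliString n f)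
    (hneg : (-1 : (Matrix (Fin n → Fin 2) (Fin n → Fin 2) ℂ)ˣ) ∉ S)
    (hcard : Nat.card S = 2 ^ (n - k)) :
    Module.finrank ℂ
      ↥(⨅ s ∈ S, LinearMap.eqLocus
        (Matrix.mulVecLin (s : Matrix (Fin n → Fin 2) (Fin n → Fin 2) ℂ))
        (LinearMap.id : ((Fin n → Fin 2) → ℂ) →ₗ[ℂ] ((Fin n → Fin 2) → ℂ))) =
      2 ^ k := by
  have : Finite S := Nat.finite_of_card_ne_zero (by rw [hcard]; positivity)
  have : Fintype S := Fintype.ofFinite S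
  have hchar (s : S) : (tautologicalRep S).character s = if s = 1 then (2 : ℂ) ^ n else 0 := by
    split_ifs with hs
    · simp [hs]
    · rw [Representation.character, tautologicalRep_apply, Matrix.trace_toLin'_eq]
      obtain ⟨f, hf⟩ := hpauli s s.2
      have hf0 : f ≠ 0 := by
        rintro rfl
        rw [PauliString_zero] at hf
        rcases hf with hf | hf
        · exact hs (Subtype.ext (Units.ext hf))
        · have hs1 : (s : (Matrix (Fin n → Fin 2) (Fin n → Fin 2) ℂ)ˣ) = -1 :=
            Units.ext (by simpa using hf)
          exact hneg (hs1 ▸ s.2)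
      rcases hf with hf | hf <;> simp [hf, trace_PauliString_of_ne_zero hf0]
  have : Invertible (Nat.card S : ℂ) := invertibleOfNonzero (by simp)
  have key := (tautologicalRep S).card_inv_mul_sum_char_eq_finrank
  rw [invariants_tautologicalRep] at key
  simp only [hchar, Finset.sum_ite_eq', Finset.mem_univ, if_true, hcard] at key
  have hpow : (2 : ℂ) ^ n = 2 ^ (n - k) * 2 ^ k := by rw [← pow_add, Nat.sub_add_cancel hk]
  rw [hpow] at key
  push_cast at key
  rw [inv_mul_cancel_left₀ (pow_ne_zero _ two_ne_zero)] at key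
  exact_mod_cast key.symm
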